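/- Let U : ℝ → ℝ be a C² solution of U'' + cU' + f(U) = 0 with 0 < U < 1, U(-∞)=1, U(+∞)=0, where f is C¹ with f'(0) < 0 and f'(1) < 0. Then U is strictly decreasing on ℝ, i.e., U'(x) < 0 for all x ∈ ℝ. -/

import Mathlib

open Filter

lemma aux_unique (f : ℝ → ℝ) (c : ℝ) (hf : ContDiff ℝ 1 f) (U V W Z : ℝ → ℝ)
    (hU : ∀ x, HasDerivAt U (V x) x) (hV : ∀ x, HasDerivAt V (-c * V x - f (U x)) x)
    (hW : ∀ x, HasDerivAt W (Z x) x) (hZ : ∀ x, HasDerivAt Z (-c * Z x - f (W x)) x)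
    (hUr : ∀ x, U x ∈ Set.Icc (0:ℝ) 1) (hWr : ∀ x, W x ∈ Set.Icc (0:ℝ) 1)
    (t : ℝ) (h1 : U t = W t) (h2 : V t = Z t) : U = W := by
  obtain ⟨K, hK⟩ := (hf.contDiffOn (s := Set.Icc (0:ℝ) 1)).exists_lipschitzOnWith one_ne_zero
    (convex_Icc _ _) isCompact_Icc
  have hlip : LipschitzOnWith (1 + ‖c‖₊ + K)
      (fun p : ℝ × ℝ => (p.2, -c * p.2 - f p.1)) {p | p.1 ∈ Set.Icc (0:ℝ) 1} := by
    apply LipschitzOnWith.of_dist_le_mul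
    intro p hp q hq
    have hk := hK.dist_le_mul p.1 hp q.1 hq
    have hp1 : dist p.1 q.1 ≤ dist p q := by rw [Prod.dist_eq]; exact le_max_left _ _
    have hp2 : dist p.2 q.2 ≤ dist p q := by rw [Prod.dist_eq]; exact le_max_right _ _
    have hK0 : (0:ℝ) ≤ K := K.2
    have hc0 : 0 ≤ |c| := abs_nonneg c
    have hd0 : 0 ≤ dist p q := dist_nonneg
    rw [Prod.dist_eq (x := (p.2, _))]
    simp only [NNReal.coe_add, NNReal.coe_one, coe_nnnorm, Real.norm_eq_abs]
    apply max_le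
    · nlinarith [mul_nonneg hK0 hd0, mul_nonneg hc0 hd0]
    · have e : dist (-c * p.2 - f p.1) (-c * q.2 - f q.1)
          ≤ |c| * dist p.2 q.2 + dist (f p.1) (f q.1) := by
        simp only [Real.dist_eq]
        rw [← abs_mul]
        have : -c * p.2 - f p.1 - (-c * q.2 - f q.1)
          = -(c * (p.2 - q.2) + (f p.1 - f q.1)) := by ring
        rw [this, abs_neg]
        exact abs_add_le _ _
      nlinarith [mul_le_mul_of_nonneg_left hp1 hK0, mul_le_mul_of_nonneg_left hp2 hc0]
  have := ODE_solution_unique_univ (v := fun _ p => (p.2, -c * p.2 - f p.1))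
    (s := fun _ => {p : ℝ × ℝ | p.1 ∈ Set.Icc (0:ℝ) 1})
    (f := fun x => (U x, V x)) (g := fun x => (W x, Z x)) (t₀ := t) (fun _ => hlip)
    (fun x => ⟨(hU x).prodMk (hV x), hUr x⟩) (fun x => ⟨(hW x).prodMk (hZ x), hWr x⟩)
    (by simp [h1, h2])
  funext x
  exact congrArg Prod.fst (congrFun this x)

lemma aux_min (w : ℝ → ℝ) (hw : Continuous w) (x : ℝ) (hm : IsLocalMin w x) :
    0 ≤ deriv (deriv w) x := by
  by_contra! h
  have hd := hm.deriv_eq_zero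
  have hM := isLocalMax_of_deriv_deriv_neg h hd hw.continuousAt
  have he : w =ᶠ[nhds x] fun _ => w x := by
    filter_upwards [hm, hM] with y h1 h2 using le_antisymm h2 h1
  have := he.deriv.deriv_eq
  simp at this
  linarith

lemma aux_strict (f : ℝ → ℝ) (hf : ContDiff ℝ 1 f) (a : ℝ) (ha : deriv f a < 0) :
    ∃ δ > 0, StrictAntiOn f (Set.Ioo (a - δ) (a + δ)) := by
  have hc : Continuous (deriv f) := hf.continuous_deriv le_rfl
  have := hc.continuousAt.eventually (gt_mem_nhds ha)
  obtain ⟨δ, hδ, h⟩ := Metric.eventually_nhds_iff_ball.1 this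
  refine ⟨δ, hδ, ?_⟩
  apply strictAntiOn_of_deriv_neg (convex_Ioo _ _) hf.continuous.continuousOn
  intro x hx
  rw [interior_Ioo, ← Real.ball_eq_Ioo] at hx
  exact h x hx

/-- A bistable travelling-wave profile is strictly decreasing:
`U'(x) < 0` for all `x`. -/
theorem stmt2 (U f : ℝ → ℝ) (c : ℝ)
    (hU : ContDiff ℝ 2 U) (hf : ContDiff ℝ 1 f)
    (hode : ∀ x : ℝ, deriv (deriv U) x + c * deriv U x + f (U x) = 0)
    (hrange : ∀ x : ℝ, U x ∈ Set.Ioo (0:ℝ) 1)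
    (hlim1 : Tendsto U atBot (nhds 1)) (hlim0 : Tendsto U atTop (nhds 0))
    (hf'0 : deriv f 0 < 0) (hf'1 : deriv f 1 < 0)
    (hd1 : Tendsto (deriv U) atBot (nhds 0))
    (hd0 : Tendsto (deriv U) atTop (nhds 0)) :
    ∀ x : ℝ, deriv U x < 0 := by
  have hUc := hU.continuous
  have hUd : ∀ x, HasDerivAt U (deriv U x) x := fun x =>
    (hU.differentiable (by norm_num) x).hasDerivAt
  have hU' : ContDiff ℝ 1 (deriv U) := by
    have : ContDiff ℝ (1 + 1) U := by norm_num; exact hU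
    exact (contDiff_succ_iff_deriv.1 this).2.2
  have hVd : ∀ x, HasDerivAt (deriv U) (-c * deriv U x - f (U x)) x := fun x => by
    have h := (hU'.differentiable (by norm_num) x).hasDerivAt
    have e : deriv (deriv U) x = -c * deriv U x - f (U x) := by linarith [hode x]
    rwa [e] at h
  have hIcc : ∀ x, U x ∈ Set.Icc (0:ℝ) 1 := fun x => Set.Ioo_subset_Icc_self (hrange x)
  obtain ⟨δ0, hδ0, hs0⟩ := aux_strict f hf 0 hf'0
  obtain ⟨δ1, hδ1, hs1⟩ := aux_strict f hf 1 hf'1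
  obtain ⟨A, hA⟩ := eventually_atTop.1 (hlim0.eventually (gt_mem_nhds hδ0))
  obtain ⟨B, hB⟩ := eventually_atBot.1
    (hlim1.eventually (lt_mem_nhds (show 1 - δ1 < 1 by linarith)))
  -- Claim A
  have claimA : ∀ τ > 0, (∀ x ∈ Set.Icc B A, U (x + τ) ≤ U x) → ∀ x, U (x + τ) ≤ U x := by
    intro τ hτ hx
    by_contra! hcon
    obtain ⟨x0, hx0⟩ := hcon
    let w : ℝ → ℝ := fun x => U x - U (x + τ)
    have hwc : Continuous w := by fun_prop
    have hwt : Tendsto w atTop (nhds 0) := by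
      simpa using hlim0.sub (hlim0.comp (tendsto_atTop_add_const_right atTop τ tendsto_id))
    have hwb : Tendsto w atBot (nhds 0) := by
      simpa using hlim1.sub (hlim1.comp (tendsto_atBot_add_const_right atBot τ tendsto_id))
    have hw0 : w x0 < 0 := sub_neg.2 hx0
    obtain ⟨y, hy⟩ := hwc.exists_forall_le' x0 (by
      rw [cocompact_eq_atBot_atTop, eventually_sup]
      exact ⟨(hwb.eventually (lt_mem_nhds hw0)).mono fun _ h => h.le,
        (hwt.eventually (lt_mem_nhds hw0)).mono fun _ h => h.le⟩)
    have hmin : IsLocalMin w y := Eventually.of_forall hy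
    have hwy : U y < U (y + τ) := sub_neg.1 ((hy x0).trans_lt hw0)
    have h2 := aux_min w hwc y hmin
    have hwd : ∀ x, HasDerivAt w (deriv U x - deriv U (x + τ)) x := fun x =>
      (hUd x).sub ((hUd (x + τ)).comp_add_const x τ)
    have hd : deriv U y - deriv U (y + τ) = 0 := (hwd y).deriv.symm.trans hmin.deriv_eq_zero
    have hwd' : deriv w = fun x => deriv U x - deriv U (x + τ) := funext fun x => (hwd x).deriv
    have e := ((hVd y).sub ((hVd (y + τ)).comp_add_const y τ)).deriv
    rw [hwd'] at h2
    have h2' : 0 ≤ -c * deriv U y - f (U y) - (-c * deriv U (y + τ) - f (U (y + τ))) :=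
      h2.trans_eq e
    have hd' : deriv U y = deriv U (y + τ) := by linarith
    rw [hd'] at h2'
    have r1 := hrange y
    have r2 := hrange (y + τ)
    rcases lt_or_ge y B with hyB | hyB
    · have b := hB y hyB.le
      have := hs1 ⟨b, by linarith [r1.2]⟩ ⟨b.trans hwy, by linarith [r2.2]⟩ hwy
      linarith
    · rcases le_or_gt y A with hyA | hyA
      · linarith [hx y ⟨hyB, hyA⟩]
      · have := hs0 ⟨by linarith [r1.1], by linarith [hA y hyA.le]⟩
          ⟨by linarith [r2.1], by linarith [hA (y + τ) (by linarith)]⟩ hwy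
        linarith
  -- sliding
  have slide : ∀ τ > 0, ∀ x, U (x + τ) ≤ U x := by
    intro τ0 hτ0
    by_contra! hcon
    have hex : ∃ x ∈ Set.Icc B A, U x < U (x + τ0) := by
      by_contra! h
      obtain ⟨x, hx⟩ := hcon
      exact absurd (claimA τ0 hτ0 h x) (not_le.2 hx)
    obtain ⟨x1, hx1, hx1'⟩ := hex
    obtain ⟨m, hm, hmin⟩ := isCompact_Icc.exists_isMinOn ⟨x1, hx1⟩ hUc.continuousOn
    obtain ⟨T, hT⟩ := eventually_atTop.1 (hlim0.eventually (gt_mem_nhds (hrange m).1))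
    have hlarge : ∀ τ ≥ T - B, ∀ x ∈ Set.Icc B A, U (x + τ) < U x := fun τ hτ x hx =>
      (hT (x + τ) (by linarith [hx.1])).trans_le (hmin hx)
    let S : Set (ℝ × ℝ) := (Set.Icc τ0 (T - B) ×ˢ Set.Icc B A) ∩ {p | U p.2 ≤ U (p.2 + p.1)}
    have hS : IsCompact S := (isCompact_Icc.prod isCompact_Icc).inter_right
      (isClosed_le (by fun_prop) (by fun_prop))
    have hτT : τ0 ≤ T - B := by
      by_contra! h
      exact absurd (hlarge τ0 h.le x1 hx1) (not_lt.2 hx1'.le)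
    have hSn : S.Nonempty := ⟨(τ0, x1), ⟨⟨le_rfl, hτT⟩, hx1⟩, hx1'.le⟩
    obtain ⟨⟨τ, y⟩, hpS, hmax⟩ := hS.exists_isMaxOn hSn continuous_fst.continuousOn
    have hτ : τ0 ≤ τ := hpS.1.1.1
    have hyS : U y ≤ U (y + τ) := hpS.2
    have hgt : ∀ σ > τ, ∀ x, U (x + σ) ≤ U x := by
      intro σ hσ
      apply claimA σ (by linarith)
      intro x hx
      rcases le_total (T - B) σ with h | h
      · exact (hlarge σ h x hx).le
      · by_contra! hlt
        have : σ ≤ τ := hmax (show (σ, x) ∈ S from ⟨⟨⟨by linarith, h⟩, hx⟩, hlt.le⟩)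
        linarith
    have hge : ∀ x, U (x + τ) ≤ U x := by
      intro x
      have ht : Tendsto (fun σ => U (x + σ)) (nhdsWithin τ (Set.Ioi τ)) (nhds (U (x + τ))) :=
        (Continuous.tendsto (by fun_prop : Continuous fun σ => U (x + σ)) τ).mono_left
          nhdsWithin_le_nhds
      exact le_of_tendsto ht (eventually_mem_nhdsWithin.mono fun σ hσ => hgt σ hσ x)
    have hEq : U y = U (y + τ) := le_antisymm hyS (hge y)
    have hmin' : IsLocalMin (fun x => U x - U (x + τ)) y := Eventually.of_forall fun x => by
      have := hge x
      simp only
      linarith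
    have hdEq := hmin'.hasDerivAt_eq_zero ((hUd y).sub ((hUd (y + τ)).comp_add_const y τ))
    have hper : U = fun x => U (x + τ) := aux_unique f c hf U (deriv U) (fun x => U (x + τ))
      (fun x => deriv U (x + τ)) hUd hVd (fun x => (hUd (x + τ)).comp_add_const x τ)
      (fun x => (hVd (x + τ)).comp_add_const x τ) hIcc (fun x => hIcc _) y hEq (by linarith)
    have hp : Function.Periodic U τ := fun x => (congrFun hper x).symm
    have hseq : Tendsto (fun n : ℕ => U ((n : ℝ) * τ)) atTop (nhds 0) :=
      hlim0.comp (tendsto_natCast_atTop_atTop.atTop_mul_const (by linarith))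
    have hc : (fun n : ℕ => U ((n : ℝ) * τ)) = fun _ => U 0 := by
      funext n
      simpa using (hp.nat_mul n) 0
    rw [hc] at hseq
    have := tendsto_nhds_unique hseq tendsto_const_nhds
    linarith [(hrange 0).1]
  have hanti : Antitone U := by
    intro a b hab
    rcases hab.eq_or_lt with h | h
    · rw [h]
    · simpa using slide (b - a) (by linarith) a
  have hle : ∀ x, deriv U x ≤ 0 := fun x => hanti.deriv_nonpos
  intro x
  refine lt_of_le_of_ne (hle x) fun h0 => ?_
  have hmx : IsLocalMax (deriv U) x := Eventually.of_forall fun y => by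
    simp only [h0]; exact hle y
  have h2 := hmx.hasDerivAt_eq_zero (hVd x)
  have hfx : f (U x) = 0 := by rw [h0] at h2; linarith
  have hconst : U = fun _ => U x := aux_unique f c hf U (deriv U) (fun _ => U x)
    (fun _ => 0) hUd hVd (fun y => hasDerivAt_const y _)
    (fun y => by simpa [hfx] using hasDerivAt_const y (0:ℝ)) hIcc (fun _ => hIcc _) x rfl h0
  rw [hconst] at hlim0
  have := tendsto_nhds_unique hlim0 tendsto_const_nhds
  linarith [(hrange x).1]
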